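/- Let K = (C, ⟨Q_1,…,Q_k⟩) be a pure-form CMI with repeated-index set 𝕀_K. If K is valid for a given joint distribution of X_1,…,X_n, then H(X_{𝕀_K} | X_C) = 0; likewise, if can(K) is valid for that distribution, then H(X_{𝕀_K} | X_C) = 0. -/

import Mathlib

open scoped Classical

namespace Paper

variable {n : ℕ}

/-- The marginal distribution of the coordinates in `α` of a joint distribution `p` of
the discrete random variables `X_1, …, X_n` (each taking countably many values, coded
as natural numbers). -/
noncomputable def marginal (p : PMF (Fin n → ℕ)) (α : Finset (Fin n)) :
    PMF ({ i // i ∈ α } → ℕ) :=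
  p.map fun x i => x i.1

/-- The Shannon (joint) entropy `H(X_α)`. -/
noncomputable def Hm (p : PMF (Fin n → ℕ)) (α : Finset (Fin n)) : ℝ :=
  ∑' y, Real.negMulLog ((marginal p α) y).toReal

/-- The conditional entropy `H(X_β | X_α) = H(X_{β ∪ α}) - H(X_α)`. -/
noncomputable def Hc (p : PMF (Fin n → ℕ)) (β α : Finset (Fin n)) : ℝ :=
  Hm p (β ∪ α) - Hm p α

/-- Every individual random variable `X_i` has finite Shannon entropy
(the series defining `H(X_i)` is summable). -/
def FiniteEntropy (p : PMF (Fin n → ℕ)) : Prop :=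
  ∀ i : Fin n, Summable fun y : ℕ => Real.negMulLog ((p.map fun x => x i) y).toReal

/-- `J(X_{Q_1}, …, X_{Q_k} | X_C) = (∑ i, H(X_{Q_i}|X_C)) - H(X_{Q_1},…,X_{Q_k}|X_C)`;
the joint conditional entropy of the tuple `(X_{Q_1},…,X_{Q_k})` equals
`H(X_{∪ i, Q_i} | X_C)` since the two tuples determine each other. -/
noncomputable def J (p : PMF (Fin n → ℕ)) (C : Finset (Fin n))
    (Qs : Multiset (Finset (Fin n))) : ℝ :=
  (Qs.map fun Q => Hc p Q C).sum - Hc p Qs.sup C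

/-- A conditional mutual independency (CMI) on `{1, …, n}`: a conditioning set `C`
together with a finite multiset `⟨Q_1, …, Q_k⟩` of subsets of `{1, …, n}`. -/
structure CMI (n : ℕ) where
  C : Finset (Fin n)
  Qs : Multiset (Finset (Fin n))

/-- `K` is valid for the joint distribution `p`. -/
def Valid (p : PMF (Fin n → ℕ)) (K : CMI n) : Prop :=
  J p K.C K.Qs = 0

/-- `K` is degenerate: valid for every finite-entropy joint distribution. -/
def Degenerate (K : CMI n) : Prop :=
  ∀ p : PMF (Fin n → ℕ), FiniteEntropy p → Valid p K

/-- `K ∼ K'`: valid for exactly the same finite-entropy joint distributions. -/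
def Equivalent (K K' : CMI n) : Prop :=
  ∀ p : PMF (Fin n → ℕ), FiniteEntropy p → (Valid p K ↔ Valid p K')

/-- `K` implies `K'`. -/
def Implies (K K' : CMI n) : Prop :=
  ∀ p : PMF (Fin n → ℕ), FiniteEntropy p → Valid p K → Valid p K'

/-- `K` is in pure form: every `Q_i` is nonempty and disjoint from `C`. -/
def IsPure (K : CMI n) : Prop :=
  ∀ Q ∈ K.Qs, Q ≠ ∅ ∧ Q ∩ K.C = ∅

/-- The pure form `pur(K) = (C, ⟨Q_i \ C : Q_i \ C ≠ ∅⟩)`. -/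
noncomputable def pur (K : CMI n) : CMI n :=
  ⟨K.C, (K.Qs.map fun Q => Q \ K.C).filter fun Q => Q ≠ ∅⟩

/-- The set `𝕀_K` of repeated indices of `K`: indices lying in `Q_i ∩ Q_j` for two
distinct entries `i ≠ j` of the multiset (automatically `∅` when `k ≤ 1`). -/
noncomputable def repSet (K : CMI n) : Finset (Fin n) :=
  Finset.univ.filter fun q => 2 ≤ Multiset.card (K.Qs.filter fun Q => q ∈ Q)

/-- The multiset `⟨P_1, …, P_t⟩` of nonempty sets among the `Q_i \ 𝕀_K`. -/
noncomputable def parts (K : CMI n) : Multiset (Finset (Fin n)) :=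
  (K.Qs.map fun Q => Q \ repSet K).filter fun P => P ≠ ∅

/-- The multiset of the `P_j`-entries of the canonical form `can(K)`
(general notation). -/
noncomputable def canParts (K : CMI n) : Multiset (Finset (Fin n)) :=
  if Multiset.card K.Qs ≤ 1 then 0
  else if repSet K ≠ ∅ ∧ Multiset.card (parts K) ≤ 1 then 0
  else parts K

/-- The canonical form `can(K)` (of a pure-form CMI); all degenerate canonical forms
`(·,⟨⟩)` are represented by `⟨∅, 0⟩`. -/
noncomputable def can (K : CMI n) : CMI n :=
  if Multiset.card K.Qs ≤ 1 then ⟨∅, 0⟩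
  else if repSet K = ∅ then ⟨K.C, parts K⟩
  else if Multiset.card (parts K) ≤ 1 then ⟨K.C, {repSet K, repSet K}⟩
  else ⟨K.C, repSet K ::ₘ repSet K ::ₘ parts K⟩

/-- `R_K^{K'}`: the CMI "`K'` conditioning on `K`"; the degenerate case `(·,⟨⟩)` is
represented by `⟨∅, 0⟩`. -/
noncomputable def RCond (K K' : CMI n) : CMI n :=
  let I := repSet (pur K)
  let I' := repSet (pur K')
  let Ts := ((canParts (pur K')).map fun P => P \ I).filter fun T => T ≠ ∅
  if I' \ I = ∅ ∧ Multiset.card Ts ≤ 1 then ⟨∅, 0⟩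
  else if I' \ I = ∅ then ⟨K'.C \ I, Ts⟩
  else if Multiset.card Ts ≤ 1 then ⟨K'.C \ I, {I' \ I, I' \ I}⟩
  else ⟨K'.C \ I, (I' \ I) ::ₘ (I' \ I) ::ₘ Ts⟩


open scoped ENNReal

section Entropy

/-- The probability that `f` takes the same value as at `x`. -/
noncomputable def lev {Ω S : Type} (p : PMF Ω) (f : Ω → S) (x : Ω) : ℝ≥0∞ := p.map f (f x)

/-- Extended-real-valued Shannon entropy of `f`, as an expectation of the information. -/
noncomputable def Ent {Ω S : Type} (p : PMF Ω) (f : Ω → S) : ℝ≥0∞ :=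
  ∑' x, p x * ENNReal.ofReal (-Real.log (lev p f x).toReal)

theorem tsum_map {Ω S : Type} (p : PMF Ω) (f : Ω → S) (G : S → ℝ≥0∞) :
    ∑' y, p.map f y * G y = ∑' x, p x * G (f x) := by
  simp only [PMF.map_apply, ← ENNReal.tsum_mul_right]
  rw [ENNReal.tsum_comm]
  refine tsum_congr fun x => ?_
  rw [tsum_eq_single (f x)]
  · simp
  · intro y hy
    simp [hy]

theorem lev_congr {Ω S T : Type} (p : PMF Ω) (f : Ω → S) (g : Ω → T)
    (h : ∀ x y, f x = f y ↔ g x = g y) : lev p f = lev p g := by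
  funext x
  simp only [lev, PMF.map_apply]
  exact tsum_congr fun y => by simp only [h x y]

theorem Ent_congr {Ω S T : Type} (p : PMF Ω) (f : Ω → S) (g : Ω → T)
    (h : ∀ x y, f x = f y ↔ g x = g y) : Ent p f = Ent p g := by
  rw [Ent, Ent, lev_congr p f g h]

theorem lev_le_one {Ω S : Type} (p : PMF Ω) (f : Ω → S) (x : Ω) : lev p f x ≤ 1 :=
  PMF.coe_le_one _ _

theorem le_lev {Ω S : Type} (p : PMF Ω) (f : Ω → S) (x : Ω) : p x ≤ lev p f x := by
  rw [lev, PMF.map_apply]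
  refine le_trans (by simp) (ENNReal.le_tsum x)

theorem lev_anti {Ω S T : Type} (p : PMF Ω) (f : Ω → S) (g : Ω → T)
    (h : ∀ x y, f x = f y → g x = g y) (x : Ω) : lev p f x ≤ lev p g x := by
  simp only [lev, PMF.map_apply]
  refine ENNReal.tsum_le_tsum fun y => ?_
  by_cases hf : f x = f y
  · simp [hf, h x y hf]
  · simp [hf]

theorem lev_pos {Ω S : Type} (p : PMF Ω) (f : Ω → S) {x : Ω} (hx : p x ≠ 0) :
    0 < (lev p f x).toReal :=
  ENNReal.toReal_pos (fun h => hx (le_antisymm (h ▸ le_lev p f x) (zero_le)))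
    (ne_top_of_le_ne_top ENNReal.one_ne_top (lev_le_one p f x))

theorem lev_toReal_le_one {Ω S : Type} (p : PMF Ω) (f : Ω → S) (x : Ω) :
    (lev p f x).toReal ≤ 1 := by
  simpa using ENNReal.toReal_mono ENNReal.one_ne_top (lev_le_one p f x)

theorem Ent_mono {Ω S T : Type} (p : PMF Ω) (f : Ω → S) (g : Ω → T)
    (h : ∀ x y, f x = f y → g x = g y) : Ent p g ≤ Ent p f := by
  refine ENNReal.tsum_le_tsum fun x => ?_
  by_cases hx : p x = 0
  · simp [hx]
  gcongr
  · exact lev_pos p f hx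
  · exact ne_top_of_le_ne_top ENNReal.one_ne_top (lev_le_one p g x)
  · exact lev_anti p f g h x

theorem ratio_le_one {Ω S T U : Type} (p : PMF Ω) (A : Ω → S) (B : Ω → T) (g : S → U) (h : T → U)
    (hgh : ∀ x, g (A x) = h (B x)) :
    ∑' x, p x * (lev p A x * lev p B x /
      (lev p (fun x => (A x, B x)) x * lev p (fun x => g (A x)) x)) ≤ 1 := by
  have e := tsum_map p (fun x => (A x, B x)) (fun st => p.map A st.1 * p.map B st.2 /
    (p.map (fun x => (A x, B x)) st * p.map (fun x => g (A x)) (g st.1)))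
  simp only [lev]
  rw [← e]
  have hC : p.map (fun x => g (A x)) = (p.map B).map h := by
    rw [PMF.map_comp]
    congr 1
    funext x
    exact hgh x
  calc _ ≤ ∑' st : S × T, p.map A st.1 * ((p.map (fun x => g (A x)) (g st.1))⁻¹ *
            (if g st.1 = h st.2 then p.map B st.2 else 0)) := by
        refine ENNReal.tsum_le_tsum fun st => ?_
        by_cases hq : p.map (fun x => (A x, B x)) st = 0
        · simp [hq]
        have hm : st ∈ (p.map (fun x => (A x, B x))).support := (PMF.mem_support_iff _ _).2 hq
        rw [PMF.mem_support_map_iff] at hm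
        obtain ⟨x, -, rfl⟩ := hm
        rw [if_pos (hgh x), div_eq_mul_inv,
          ENNReal.mul_inv (Or.inl hq) (Or.inl (PMF.apply_ne_top _ _))]
        set q := p.map (fun x => (A x, B x)) (A x, B x)
        have : q * q⁻¹ = 1 := ENNReal.mul_inv_cancel hq (PMF.apply_ne_top _ _)
        apply le_of_eq
        calc _ = (q * q⁻¹) * (p.map A (A x) * ((p.map (fun x => g (A x)) (g (A x)))⁻¹ *
            p.map B (B x))) := by ring
          _ = _ := by rw [this, one_mul]
    _ = ∑' s, p.map A s * ((p.map (fun x => g (A x)) (g s))⁻¹ *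
          p.map (fun x => g (A x)) (g s)) := by
        rw [ENNReal.tsum_prod']
        refine tsum_congr fun s => ?_
        simp only [ENNReal.tsum_mul_left]
        congr 2
        rw [hC, PMF.map_apply]
    _ ≤ ∑' s, p.map A s := by
        refine ENNReal.tsum_le_tsum fun s => ?_
        exact mul_le_of_le_one_right' (ENNReal.inv_mul_le_one _)
    _ = 1 := PMF.tsum_coe _

theorem Ent_submod {Ω S T U : Type} (p : PMF Ω) (A : Ω → S) (B : Ω → T) (g : S → U) (h : T → U)
    (hgh : ∀ x, g (A x) = h (B x)) :
    Ent p (fun x => (A x, B x)) + Ent p (fun x => g (A x)) ≤ Ent p A + Ent p B := by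
  have key : Ent p (fun x => (A x, B x)) + Ent p (fun x => g (A x)) + 1 ≤
      Ent p A + Ent p B + 1 := by
    refine le_trans ?_ (add_le_add_right (ratio_le_one p A B g h hgh) _)
    have h1 : (1 : ℝ≥0∞) = ∑' x, p x * 1 := by simp [PMF.tsum_coe]
    rw [h1]
    simp only [Ent, ← ENNReal.tsum_add, ← mul_add]
    refine ENNReal.tsum_le_tsum fun x => ?_
    by_cases hx : p x = 0
    · simp [hx]
    refine mul_le_mul_right ?_ (p x)
    have pa := lev_pos p A hx
    have pb := lev_pos p B hx
    have pd := lev_pos p (fun x => (A x, B x)) hx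
    have pc := lev_pos p (fun x => g (A x)) hx
    have la := lev_toReal_le_one p A x
    have lb := lev_toReal_le_one p B x
    have ld := lev_toReal_le_one p (fun x => (A x, B x)) x
    have lc := lev_toReal_le_one p (fun x => g (A x)) x
    have na := Real.log_nonpos pa.le la
    have nb := Real.log_nonpos pb.le lb
    have nd := Real.log_nonpos pd.le ld
    have nc := Real.log_nonpos pc.le lc
    have hr : lev p A x * lev p B x /
      (lev p (fun x => (A x, B x)) x * lev p (fun x => g (A x)) x) = ENNReal.ofReal
        ((lev p A x).toReal * (lev p B x).toReal /
      ((lev p (fun x => (A x, B x)) x).toReal * (lev p (fun x => g (A x)) x).toReal)) := by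
      have nt : ∀ {V : Type} (f : Ω → V), ENNReal.ofReal (lev p f x).toReal = lev p f x :=
        fun f => ENNReal.ofReal_toReal
          (ne_top_of_le_ne_top ENNReal.one_ne_top (lev_le_one p f x))
      rw [ENNReal.ofReal_div_of_pos (by positivity), ENNReal.ofReal_mul pa.le,
        ENNReal.ofReal_mul pd.le, nt, nt, nt, nt]
    rw [hr]
    generalize (lev p A x).toReal = a at *
    generalize (lev p B x).toReal = b at *
    generalize (lev p (fun x => (A x, B x)) x).toReal = d at *
    generalize (lev p (fun x => g (A x)) x).toReal = c at *
    have hlog := Real.log_le_sub_one_of_pos (x := a * b / (d * c)) (by positivity)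
    rw [Real.log_div (by positivity) (by positivity), Real.log_mul pa.ne' pb.ne',
      Real.log_mul pd.ne' pc.ne'] at hlog
    have hpos : 0 ≤ a * b / (d * c) := by positivity
    rw [← ENNReal.ofReal_one, ← ENNReal.ofReal_add (by linarith) (by linarith),
      ← ENNReal.ofReal_add (by linarith) (by linarith),
      ← ENNReal.ofReal_add (by linarith) (by linarith),
      ← ENNReal.ofReal_add (by linarith) (by linarith)]
    apply ENNReal.ofReal_le_ofReal
    linarith
  exact (ENNReal.add_le_add_iff_right ENNReal.one_ne_top).1 key

theorem Ent_eq_tsum {Ω S : Type} (p : PMF Ω) (f : Ω → S) :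
    Ent p f = ∑' y, ENNReal.ofReal (Real.negMulLog (p.map f y).toReal) := by
  rw [Ent]
  simp only [lev]
  rw [← tsum_map p f (fun y => ENNReal.ofReal (-Real.log (p.map f y).toReal))]
  refine tsum_congr fun y => ?_
  rw [Real.negMulLog, neg_mul_comm, ENNReal.ofReal_mul ENNReal.toReal_nonneg,
    ENNReal.ofReal_toReal (PMF.apply_ne_top _ _)]

theorem negMulLog_pmf_nonneg {S : Type} (q : PMF S) (y : S) :
    0 ≤ Real.negMulLog (q y).toReal :=
  Real.negMulLog_nonneg ENNReal.toReal_nonneg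
    (by simpa using ENNReal.toReal_mono ENNReal.one_ne_top (PMF.coe_le_one q y))

theorem Ent_toReal {Ω S : Type} (p : PMF Ω) (f : Ω → S) :
    (Ent p f).toReal = ∑' y, Real.negMulLog (p.map f y).toReal := by
  rw [Ent_eq_tsum, ENNReal.tsum_toReal_eq (fun _ => ENNReal.ofReal_ne_top)]
  exact tsum_congr fun y => ENNReal.toReal_ofReal (negMulLog_pmf_nonneg _ _)

end Entropy

/-- Restriction of a tuple to the coordinates in `α`. -/
def restr (α : Finset (Fin n)) (x : Fin n → ℕ) : { i // i ∈ α } → ℕ := fun i => x i.1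

theorem restr_eq_iff (α : Finset (Fin n)) (x y : Fin n → ℕ) :
    restr α x = restr α y ↔ ∀ i ∈ α, x i = y i := by
  simp [restr, funext_iff]

theorem Hm_eq (p : PMF (Fin n → ℕ)) (α : Finset (Fin n)) :
    Hm p α = (Ent p (restr α)).toReal := (Ent_toReal p (restr α)).symm

theorem Ent_restr_submod (p : PMF (Fin n → ℕ)) (α β : Finset (Fin n)) :
    Ent p (restr (α ∪ β)) + Ent p (restr (α ∩ β)) ≤ Ent p (restr α) + Ent p (restr β) := by
  have h := Ent_submod p (restr α) (restr β)
    (fun a (i : { i // i ∈ α ∩ β }) => a ⟨i.1, (Finset.mem_inter.1 i.2).1⟩)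
    (fun b (i : { i // i ∈ α ∩ β }) => b ⟨i.1, (Finset.mem_inter.1 i.2).2⟩)
    (fun x => rfl)
  rw [Ent_congr p (restr (α ∪ β)) (fun x => (restr α x, restr β x))]
  · exact h
  · intro x y
    simp only [Prod.mk.injEq, restr_eq_iff, Finset.mem_union]
    exact ⟨fun h => ⟨fun i hi => h i (Or.inl hi), fun i hi => h i (Or.inr hi)⟩,
      fun h i hi => hi.elim (h.1 i) (h.2 i)⟩

theorem Ent_restr_ne_top (p : PMF (Fin n → ℕ)) (hp : FiniteEntropy p) (α : Finset (Fin n)) :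
    Ent p (restr α) ≠ ⊤ := by
  induction α using Finset.induction_on with
  | empty =>
    have hl : ∀ x, lev p (restr (∅ : Finset (Fin n))) x = 1 := by
      intro x
      rw [lev, PMF.map_apply, ← PMF.tsum_coe p]
      exact tsum_congr fun y => if_pos ((restr_eq_iff _ _ _).2 (by simp))
    simp [Ent, hl]
  | insert i s hi ih =>
    have h1 : Ent p (restr {i}) ≠ ⊤ := by
      rw [Ent_congr p (restr {i}) (fun x => x i) (fun x y => by simp [restr_eq_iff]), Ent_eq_tsum]
      exact (hp i).tsum_ofReal_ne_top
    rw [Finset.insert_eq]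
    exact ne_top_of_le_ne_top (ENNReal.add_ne_top.2 ⟨h1, ih⟩)
      (le_trans le_self_add (Ent_restr_submod p {i} s))

theorem Hm_submod (p : PMF (Fin n → ℕ)) (hp : FiniteEntropy p) (α β : Finset (Fin n)) :
    Hm p (α ∪ β) + Hm p (α ∩ β) ≤ Hm p α + Hm p β := by
  have t := Ent_restr_ne_top p hp
  simp only [Hm_eq]
  rw [← ENNReal.toReal_add (t _) (t _), ← ENNReal.toReal_add (t _) (t _)]
  exact ENNReal.toReal_mono (ENNReal.add_ne_top.2 ⟨t _, t _⟩) (Ent_restr_submod p α β)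

theorem Hm_mono (p : PMF (Fin n → ℕ)) (hp : FiniteEntropy p) {α β : Finset (Fin n)}
    (h : α ⊆ β) : Hm p α ≤ Hm p β := by
  simp only [Hm_eq]
  refine ENNReal.toReal_mono (Ent_restr_ne_top p hp β) (Ent_mono p _ _ fun x y => ?_)
  simp only [restr_eq_iff]
  exact fun hh i hi => hh i (h hi)

theorem Hc_mono (p : PMF (Fin n → ℕ)) (hp : FiniteEntropy p) (C : Finset (Fin n))
    {α β : Finset (Fin n)} (h : α ⊆ β) : Hc p α C ≤ Hc p β C := by
  have := Hm_mono p hp (Finset.union_subset_union_left (t := C) h)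
  simp only [Hc]
  linarith

theorem Hc_nonneg (p : PMF (Fin n → ℕ)) (hp : FiniteEntropy p) (C α : Finset (Fin n)) :
    0 ≤ Hc p α C := by
  have := Hm_mono p hp (Finset.subset_union_right : C ⊆ α ∪ C)
  simp only [Hc]
  linarith

theorem Hc_submod (p : PMF (Fin n → ℕ)) (hp : FiniteEntropy p) (C α β : Finset (Fin n)) :
    Hc p (α ∪ β) C + Hc p (α ∩ β) C ≤ Hc p α C + Hc p β C := by
  have := Hm_submod p hp (α ∪ C) (β ∪ C)
  rw [← Finset.union_union_distrib_right, ← Finset.inter_union_distrib_right] at this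
  simp only [Hc]
  linarith

theorem rep_bound (p : PMF (Fin n → ℕ)) (hp : FiniteEntropy p) (C : Finset (Fin n))
    (Qs : Multiset (Finset (Fin n))) :
    Hc p Qs.sup C + Hc p (repSet ⟨C, Qs⟩) C ≤ (Qs.map fun Q => Hc p Q C).sum := by
  induction Qs using Multiset.induction_on with
  | empty => simp [Hc, repSet]
  | cons Q Qs ih =>
    have hr : repSet ⟨C, Q ::ₘ Qs⟩ ⊆ repSet ⟨C, Qs⟩ ∪ (Q ∩ Qs.sup) := by
      intro q hq
      simp only [repSet, Finset.mem_filter, Finset.mem_univ, true_and, Finset.mem_union,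
        Finset.mem_inter] at hq ⊢
      by_cases h : q ∈ Q
      · rw [Multiset.filter_cons_of_pos (p := fun Q => q ∈ Q) _ h, Multiset.card_cons] at hq
        right
        refine ⟨h, ?_⟩
        have : 0 < Multiset.card (Qs.filter fun Q => q ∈ Q) := by omega
        obtain ⟨R, hR⟩ := Multiset.card_pos_iff_exists_mem.1 this
        rw [Multiset.mem_filter] at hR
        exact (Multiset.le_sup hR.1) hR.2
      · rw [Multiset.filter_cons_of_neg (p := fun Q => q ∈ Q) _ h] at hq
        exact Or.inl hq
    have h1 := Hc_mono p hp C hr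
    have h2 := Hc_submod p hp C (repSet ⟨C, Qs⟩) (Q ∩ Qs.sup)
    have h3 := Hc_nonneg p hp C (repSet ⟨C, Qs⟩ ∩ (Q ∩ Qs.sup))
    have h4 := Hc_submod p hp C Q Qs.sup
    rw [Multiset.sup_cons, Multiset.map_cons, Multiset.sum_cons, Finset.sup_eq_union]
    linarith

theorem Hc_rep_of_valid (p : PMF (Fin n → ℕ)) (hp : FiniteEntropy p) (K : CMI n)
    (h : Valid p K) : Hc p (repSet K) K.C = 0 := by
  have h1 := rep_bound p hp K.C K.Qs
  have h2 := Hc_nonneg p hp K.C (repSet K)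
  have h3 : (K.Qs.map fun Q => Hc p Q K.C).sum - Hc p K.Qs.sup K.C = 0 := h
  have h4 : (⟨K.C, K.Qs⟩ : CMI n) = K := rfl
  rw [h4] at h1
  linarith

/-- for a pure-form CMI `K`, validity of `K` (resp. of `can(K)`)
implies `H(X_{𝕀_K} | X_C) = 0`. -/
theorem stmt3 {n : ℕ} (K : CMI n) (hpure : IsPure K)
    (p : PMF (Fin n → ℕ)) (hp : FiniteEntropy p) :
    (Valid p K → Hc p (repSet K) K.C = 0) ∧
      (Valid p (can K) → Hc p (repSet K) K.C = 0) := by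
  refine ⟨fun h => Hc_rep_of_valid p hp K h, fun h => ?_⟩
  by_cases h0 : repSet K = ∅
  · rw [h0]; simp [Hc]
  have hcard : ¬ Multiset.card K.Qs ≤ 1 := by
    intro hc
    apply h0
    ext q
    simp only [repSet, Finset.mem_filter, Finset.mem_univ, true_and, Finset.notMem_empty,
      iff_false, not_le]
    have := Multiset.card_le_card (Multiset.filter_le (fun Q => q ∈ Q) K.Qs)
    omega
  have hC : (can K).C = K.C := by
    unfold can; split_ifs <;> rfl
  have hsub : repSet K ⊆ repSet (can K) := by
    intro q hq
    have : {repSet K, repSet K} ≤ (can K).Qs := by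
      unfold can; split_ifs
      · exact le_rfl
      · exact Multiset.cons_le_cons _ (Multiset.cons_le_cons _ (Multiset.zero_le _))
    have h2 := Multiset.card_le_card (Multiset.filter_le_filter (fun Q => q ∈ Q) this)
    simp only [repSet, Finset.mem_filter, Finset.mem_univ, true_and]
    refine le_trans ?_ h2
    simp [Multiset.filter_cons, Multiset.insert_eq_cons, hq, ← Multiset.cons_zero]
  have h1 := Hc_rep_of_valid p hp (can K) h
  rw [hC] at h1
  have h3 := Hc_mono p hp K.C hsub
  have h4 := Hc_nonneg p hp K.C (repSet K)
  linarith

end Paper
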